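/- arXiv:1106.0612 — 10 statements merged into one kernel-verified Lean document; each statement's English description precedes it below -/
import Mathlib

section
/- (Bäcklund transformation for (H_II).) Let η, c ∈ ℂ with η ≠ 0, let U ⊆ ℂ be open, and let λ, ν : U → ℂ satisfy, for every t ∈ U: λ has derivative η·ν(t) at t, ν has derivative η·(2λ(t)³ + t·λ(t) + c) at t, and ν(t) − λ(t)² − t/2 ≠ 0. Define Λ(t) := −λ(t) + (c − η^{−1}/2)/(ν(t) − λ(t)² − t/2) and N(t) := −ν(t) + 2(c − η^{−1}/2)·λ(t)/(ν(t) − λ(t)² − t/2) − ((c − η^{−1}/2)/(ν(t) − λ(t)² − t/2))². Then for every t ∈ U, Λ has derivative η·N(t) at t and N has derivative η·(2Λ(t)³ + t·Λ(t) + c − η^{−1}) at t; consequently Λ satisfies d²Λ/dt² = η²(2Λ³ + tΛ + (c − η^{−1})). -/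
/-- Bäcklund transformation for the Hamiltonian form `(H_II)` of the second
Painlevé equation: if `(λ, ν)` solves `λ' = η·ν`, `ν' = η·(2λ³ + tλ + c)` on an
open set `U` and `ν − λ² − t/2 ≠ 0` there, then
`Λ = −λ + (c − η⁻¹/2)/(ν − λ² − t/2)` and
`N = −ν + 2(c − η⁻¹/2)λ/(ν − λ² − t/2) − ((c − η⁻¹/2)/(ν − λ² − t/2))²`
solve the system with parameter `c − η⁻¹`; consequently `Λ` satisfies
`Λ'' = η²(2Λ³ + tΛ + (c − η⁻¹))`. -/
theorem backlund_transformation_PII (η c : ℂ) (hη : η ≠ 0) (U : Set ℂ)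
    (hU : IsOpen U) (lam nu : ℂ → ℂ)
    (hlam : ∀ t ∈ U, HasDerivAt lam (η * nu t) t)
    (hnu : ∀ t ∈ U, HasDerivAt nu (η * (2 * lam t ^ 3 + t * lam t + c)) t)
    (hne : ∀ t ∈ U, nu t - lam t ^ 2 - t / 2 ≠ 0) :
    let Lam : ℂ → ℂ := fun t =>
      -lam t + (c - η⁻¹ / 2) / (nu t - lam t ^ 2 - t / 2)
    let N : ℂ → ℂ := fun t =>
      -nu t + 2 * (c - η⁻¹ / 2) * lam t / (nu t - lam t ^ 2 - t / 2) -
        ((c - η⁻¹ / 2) / (nu t - lam t ^ 2 - t / 2)) ^ 2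
    ∀ t ∈ U,
      HasDerivAt Lam (η * N t) t ∧
      HasDerivAt N (η * (2 * Lam t ^ 3 + t * Lam t + (c - η⁻¹))) t ∧
      HasDerivAt (fun u => η * N u)
        (η ^ 2 * (2 * Lam t ^ 3 + t * Lam t + (c - η⁻¹))) t := by
  intro Lam N t ht
  set k : ℂ := c - η⁻¹ / 2 with hk
  have hlt := hlam t ht
  have hnt := hnu t ht
  have hf := hne t ht
  have hηk : η * k = η * c - 1 / 2 := by
    rw [hk]
    field_simp
  have hfder : HasDerivAt (fun u => nu u - lam u ^ 2 - u / 2)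
      (η * (k - 2 * lam t * (nu t - lam t ^ 2 - t / 2))) t := by
    refine ((hnt.sub (hlt.pow 2)).sub ((hasDerivAt_id t).div_const 2)).congr_deriv ?_
    push_cast
    linear_combination -hηk
  have hwder : HasDerivAt (fun u => k / (nu u - lam u ^ 2 - u / 2))
      (η * (2 * lam t * (k / (nu t - lam t ^ 2 - t / 2)) -
        (k / (nu t - lam t ^ 2 - t / 2)) ^ 2)) t := by
    refine ((hasDerivAt_const t k).div hfder hf).congr_deriv ?_
    generalize nu t - lam t ^ 2 - t / 2 = f at hf ⊢
    field_simp
    ring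
  have hwf : k / (nu t - lam t ^ 2 - t / 2) * (nu t - lam t ^ 2 - t / 2) = k :=
    div_mul_cancel₀ k hf
  have hLam : HasDerivAt Lam (η * N t) t := by
    refine (hlt.neg.add hwder).congr_deriv ?_
    simp only [N]
    ring
  have hN : HasDerivAt N (η * (2 * Lam t ^ 3 + t * Lam t + (c - η⁻¹))) t := by
    have hN_eq : N = fun u => -nu u + 2 * (lam u * (k / (nu u - lam u ^ 2 - u / 2))) -
        (k / (nu u - lam u ^ 2 - u / 2)) ^ 2 := by
      funext u
      simp only [N]
      ring
    rw [hN_eq]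
    refine ((hnt.neg.add ((hlt.mul hwder).const_mul 2)).sub (hwder.pow 2)).congr_deriv ?_
    simp only [Lam]
    generalize k / (nu t - lam t ^ 2 - t / 2) = w at hwf ⊢
    push_cast
    linear_combination 2 * η * hwf + 2 * η * hk
  refine ⟨hLam, hN, (hN.const_mul η).congr_deriv ?_⟩
  ring
end

section
/- (Schlesinger transformation for (SL_II).) Let t, c, η, λ, ν ∈ ℂ with η ≠ 0 and d := ν − λ² − t/2 ≠ 0. Set b := c − η^{−1}/2, Λ := −λ + b/d, N := −ν + 2bλ/d − (b/d)², K := (ν² − (λ⁴ + tλ² + 2cλ))/2, K̂ := (N² − (Λ⁴ + tΛ² + 2(c − η^{−1})Λ))/2, Q(x) := x⁴ + tx² + 2cx + 2K − η^{−1}·ν/(x−λ) + η^{−2}·3/(4(x−λ)²), and Q̂(x) := x⁴ + tx² + 2(c − η^{−1})x + 2K̂ − η^{−1}·N/(x−Λ) + η^{−2}·3/(4(x−Λ)²). Let V ⊆ ℂ∖{λ, Λ} be open and let h : V → ℂ be differentiable with h(x)² = 1/((x−Λ)(x−λ)) on V; set f(x) := h(x)·(x² − λ² + ν − η^{−1}/(2(x−λ)))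 and g(x) := −η^{−1}·h(x). If ψ : V → ℂ is twice differentiable and ψ''(x) = η²·Q(x)·ψ(x) on V, then φ := f·ψ + g·ψ' satisfies φ''(x) = η²·Q̂(x)·φ(x) on V. -/
/-- If `R' = -2·s·R`, the gauge transformation `φ = h·F·ψ - η⁻¹·h·ψ'` with `h' = s·h` maps
solutions of `ψ'' = η²·(F² + η⁻¹·F' + R)·ψ` to solutions of a Schrödinger equation whose
potential is changed by `-2·η⁻¹·(s·F + F') + η⁻²·(s² + s')`. -/
theorem hasDerivAt_gauge_transform {η : ℂ} (hη : η ≠ 0) {h F s R ψ ψ' : ℂ → ℂ} {F' s' x : ℂ}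
    (hh : HasDerivAt h (s x * h x) x) (hF : HasDerivAt F F' x) (hs : HasDerivAt s s' x)
    (hR : HasDerivAt R (-2 * s x * R x) x) (hψ : HasDerivAt ψ (ψ' x) x)
    (hψ' : HasDerivAt ψ' (η ^ 2 * (F x ^ 2 + η⁻¹ * F' + R x) * ψ x) x) :
    HasDerivAt (fun z => h z * F z * ψ z + -η⁻¹ * h z * ψ' z)
      (h x * ((s x * F x - η * F x ^ 2 - η * R x) * ψ x + (F x - η⁻¹ * s x) * ψ' x)) x ∧
    HasDerivAt
      (fun z => h z *
        ((s z * F z - η * F z ^ 2 - η * R z) * ψ z + (F z - η⁻¹ * s z) * ψ' z))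
      (η ^ 2 * (F x ^ 2 + η⁻¹ * F' + R x - 2 * η⁻¹ * (s x * F x + F') +
        η⁻¹ ^ 2 * (s x ^ 2 + s')) * (h x * F x * ψ x + -η⁻¹ * h x * ψ' x)) x := by
  constructor
  · refine HasDerivAt.congr_deriv (((hh.mul hF).mul hψ).add ((hh.const_mul (-η⁻¹)).mul hψ')) ?_
    simp only [Pi.mul_apply]
    field_simp
    ring
  · refine HasDerivAt.congr_deriv (hh.mul (((((hs.mul hF).sub ((hF.pow 2).const_mul η)).sub (hR.const_mul η)).mul hψ).add
      ((hF.sub (hs.const_mul η⁻¹)).mul hψ'))) ?_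
    simp only [Pi.mul_apply, Pi.sub_apply, Pi.pow_apply]
    field_simp
    ring

/-- A differentiable branch `h` of `((z - a)·(z - b))^(-1/2)` has logarithmic derivative
`-(1/(z - a) + 1/(z - b))/2`. -/
theorem hasDerivAt_of_sq_eq_one_div {a b x : ℂ} {h : ℂ → ℂ} (hxa : x ≠ a) (hxb : x ≠ b)
    (hd : DifferentiableAt ℂ h x)
    (hsq : ∀ᶠ z in nhds x, h z ^ 2 = 1 / ((z - a) * (z - b))) :
    HasDerivAt h (-((x - a)⁻¹ + (x - b)⁻¹) / 2 * h x) x := by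
  have ha : x - a ≠ 0 := sub_ne_zero.mpr hxa
  have hb : x - b ≠ 0 := sub_ne_zero.mpr hxb
  have hx : h x ^ 2 = 1 / ((x - a) * (x - b)) := hsq.self_of_nhds
  have hh : h x ≠ 0 := by
    intro h0
    rw [h0] at hx
    field_simp at hx
    simp at hx
  have h1 : HasDerivAt (fun z => h z ^ 2 * ((z - a) * (z - b))) _ x :=
    (hd.hasDerivAt.pow 2).mul (((hasDerivAt_id x).sub_const a).mul ((hasDerivAt_id x).sub_const b))
  have h2 : HasDerivAt (fun z => h z ^ 2 * ((z - a) * (z - b))) 0 x := by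
    refine (hasDerivAt_const x (1 : ℂ)).congr_of_eventuallyEq ?_
    filter_upwards [hsq, eventually_ne_nhds hxa, eventually_ne_nhds hxb] with z hz hza hzb
    rw [hz, one_div_mul_cancel (mul_ne_zero (sub_ne_zero.mpr hza) (sub_ne_zero.mpr hzb))]
  have h3 := h1.unique h2
  simp only [Pi.pow_apply, id] at h3
  refine hd.hasDerivAt.congr_deriv ?_
  have h4 : h x * (2 * deriv h x * ((x - a) * (x - b)) + h x * ((x - b) + (x - a))) = 0 := by
    rw [← h3]; push_cast; ring
  have h5 := (mul_eq_zero.mp h4).resolve_left hh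
  field_simp
  linear_combination h5

/-- Schlesinger transformation for `(SL_II)`: the gauge transformation
`φ = f·ψ + g·ψ'` with `f = h·(x² − λ² + ν − η⁻¹/(2(x−λ)))`, `g = −η⁻¹·h`,
`h² = 1/((x−Λ)(x−λ))`, sends solutions of `ψ'' = η²·Q·ψ` (parameter `c`) to
solutions of `φ'' = η²·Q̂·φ` (parameter `c − η⁻¹`), where `(Λ, N)` is the
Bäcklund transform of `(λ, ν)`. -/
theorem schlesinger_transformation_SLII (t c η lam nu : ℂ) (hη : η ≠ 0)
    (hd : nu - lam ^ 2 - t / 2 ≠ 0) :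
    let d : ℂ := nu - lam ^ 2 - t / 2
    let b : ℂ := c - η⁻¹ / 2
    let Lam : ℂ := -lam + b / d
    let N : ℂ := -nu + 2 * b * lam / d - (b / d) ^ 2
    let K : ℂ := (nu ^ 2 - (lam ^ 4 + t * lam ^ 2 + 2 * c * lam)) / 2
    let Khat : ℂ := (N ^ 2 - (Lam ^ 4 + t * Lam ^ 2 + 2 * (c - η⁻¹) * Lam)) / 2
    let Q : ℂ → ℂ := fun x => x ^ 4 + t * x ^ 2 + 2 * c * x + 2 * K -
      η⁻¹ * nu / (x - lam) + η⁻¹ ^ 2 * 3 / (4 * (x - lam) ^ 2)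
    let Qhat : ℂ → ℂ := fun x => x ^ 4 + t * x ^ 2 + 2 * (c - η⁻¹) * x + 2 * Khat -
      η⁻¹ * N / (x - Lam) + η⁻¹ ^ 2 * 3 / (4 * (x - Lam) ^ 2)
    ∀ (V : Set ℂ), IsOpen V → V ⊆ {x : ℂ | x ≠ lam ∧ x ≠ Lam} →
    ∀ (h : ℂ → ℂ), (∀ x ∈ V, DifferentiableAt ℂ h x) →
      (∀ x ∈ V, h x ^ 2 = 1 / ((x - Lam) * (x - lam))) →
    ∀ (ψ ψ' : ℂ → ℂ),
      (∀ x ∈ V, HasDerivAt ψ (ψ' x) x) →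
      (∀ x ∈ V, HasDerivAt ψ' (η ^ 2 * Q x * ψ x) x) →
    let f : ℂ → ℂ := fun x =>
      h x * (x ^ 2 - lam ^ 2 + nu - η⁻¹ / (2 * (x - lam)))
    let g : ℂ → ℂ := fun x => -η⁻¹ * h x
    let φ : ℂ → ℂ := fun x => f x * ψ x + g x * ψ' x
    ∃ φ' : ℂ → ℂ, ∀ x ∈ V,
      HasDerivAt φ (φ' x) x ∧ HasDerivAt φ' (η ^ 2 * Qhat x * φ x) x := by
  intro d b Lam N K Khat Q Qhat V hV hVsub h hdiff hsq ψ ψ' hψ hψ' f g φ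
  obtain ⟨q, hq⟩ : ∃ q, q = b / d := ⟨_, rfl⟩
  have hc : c = q * d + η⁻¹ / 2 := by
    rw [hq, div_mul_cancel₀ b hd]
    ring
  have ht : t = 2 * (nu - lam ^ 2 - d) := by ring
  have hLam : Lam = -lam + q := by rw [hq]
  have hN : N = -nu + 2 * q * lam - q ^ 2 := by
    rw [hq]
    ring
  let F : ℂ → ℂ := fun x => x ^ 2 - lam ^ 2 + nu - η⁻¹ / (2 * (x - lam))
  let s : ℂ → ℂ := fun x => -((x - Lam)⁻¹ + (x - lam)⁻¹) / 2
  let R : ℂ → ℂ := fun x => -2 * d * ((x - lam) * (x - Lam))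
  refine ⟨fun z => h z *
    ((s z * F z - η * F z ^ 2 - η * R z) * ψ z + (F z - η⁻¹ * s z) * ψ' z), fun x hx => ?_⟩
  obtain ⟨hxl, hxL⟩ := hVsub hx
  have hl : x - lam ≠ 0 := sub_ne_zero.mpr hxl
  have hL : x - Lam ≠ 0 := sub_ne_zero.mpr hxL
  have hh : HasDerivAt h (s x * h x) x :=
    hasDerivAt_of_sq_eq_one_div hxL hxl (hdiff x hx)
      (Filter.eventually_of_mem (hV.mem_nhds hx) hsq)
  have dl : HasDerivAt (fun z : ℂ => z - lam) 1 x := (hasDerivAt_id x).sub_const lam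
  have dL : HasDerivAt (fun z : ℂ => z - Lam) 1 x := (hasDerivAt_id x).sub_const Lam
  have hF : HasDerivAt F (2 * x + η⁻¹ / (2 * (x - lam) ^ 2)) x := by
    refine HasDerivAt.congr_deriv (((((hasDerivAt_id x).pow 2).sub_const (lam ^ 2)).add_const nu).sub
      ((hasDerivAt_const x η⁻¹).div (dl.const_mul 2) (mul_ne_zero two_ne_zero hl))) ?_
    simp only [id]
    field_simp
    ring
  have hs : HasDerivAt s ((((x - Lam) ^ 2)⁻¹ + ((x - lam) ^ 2)⁻¹) / 2) x := by
    refine HasDerivAt.congr_deriv (((dL.inv hL).add (dl.inv hl)).neg.div_const 2) ?_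
    field_simp
    ring
  have hR : HasDerivAt R (-2 * s x * R x) x := by
    refine HasDerivAt.congr_deriv ((dl.mul dL).const_mul (-2 * d)) ?_
    simp only [s, R]
    field_simp
    ring
  have hQ : Q x = F x ^ 2 + η⁻¹ * (2 * x + η⁻¹ / (2 * (x - lam) ^ 2)) + R x := by
    simp only [Q, F, R, K, hLam]
    clear_value d
    rw [hc, ht]
    generalize η⁻¹ = e
    field_simp
    ring
  have hQhat : Qhat x = F x ^ 2 + η⁻¹ * (2 * x + η⁻¹ / (2 * (x - lam) ^ 2)) + R x -
      2 * η⁻¹ * (s x * F x + (2 * x + η⁻¹ / (2 * (x - lam) ^ 2))) +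
      η⁻¹ ^ 2 * (s x ^ 2 + (((x - Lam) ^ 2)⁻¹ + ((x - lam) ^ 2)⁻¹) / 2) := by
    simp only [Qhat, F, R, s, Khat, hN]
    clear_value Lam d
    subst hLam
    rw [hc, ht]
    generalize η⁻¹ = e
    field_simp
    ring
  have hψx := hψ' x hx
  rw [hQ] at hψx
  rw [hQhat]
  exact hasDerivAt_gauge_transform hη hh hF hs hR (hψ x hx) hψx
end

section
/- (Explicit primitive of R_{−1} = √Δ.) Let c ∈ ℂ, let U ⊆ ℂ be open, and let λ, s, L : U → ℂ be differentiable functions such that for every t ∈ U: 2λ(t)³ + t·λ(t) + c = 0, λ(t) ≠ 0, s(t)² = 6λ(t)² + t, 6λ(t)² + t ≠ 0, 2λ(t) + s(t) ≠ 0, and exp(L(t)) = (2λ(t) − s(t))/(2λ(t) + s(t)). Then for every t ∈ U the function t ↦ (4/3)·t·s(t) − 2c·L(t) has derivative 2·s(t) at t. (This verifies the paper's explicit formula ∫_{Γ_t} R_{−1} dt = (4/3)t√Δ − 2c·log((2λ₀−√Δ)/(2λ₀+√Δ)) for the integral of R_{−1} = √Δ along the doubled contour Γ_t.) -/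
/-- Explicit primitive of `R₋₁ = √Δ` for `(P_II)`: if `λ(t)` is a root of the
cubic `2λ³ + tλ + c = 0`, `s(t)² = Δ(t) = 6λ(t)² + t` and
`exp(L(t)) = (2λ(t) − s(t))/(2λ(t) + s(t))`, with `λ, s, L` differentiable,
then `(4/3)·t·s(t) − 2c·L(t)` is a primitive of `2·s(t)`, verifying
`∫_{Γ_t} R₋₁ dt = (4/3)t√Δ − 2c·log((2λ₀−√Δ)/(2λ₀+√Δ))`. -/
theorem primitive_of_R_neg_one (c : ℂ) (U : Set ℂ) (hU : IsOpen U)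
    (lam s L : ℂ → ℂ)
    (hlam : ∀ t ∈ U, DifferentiableAt ℂ lam t)
    (hs : ∀ t ∈ U, DifferentiableAt ℂ s t)
    (hL : ∀ t ∈ U, DifferentiableAt ℂ L t)
    (hcubic : ∀ t ∈ U, 2 * lam t ^ 3 + t * lam t + c = 0)
    (hlam0 : ∀ t ∈ U, lam t ≠ 0)
    (hsq : ∀ t ∈ U, s t ^ 2 = 6 * lam t ^ 2 + t)
    (hΔ : ∀ t ∈ U, 6 * lam t ^ 2 + t ≠ 0)
    (hden : ∀ t ∈ U, 2 * lam t + s t ≠ 0)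
    (hexp : ∀ t ∈ U, Complex.exp (L t) = (2 * lam t - s t) / (2 * lam t + s t)) :
    ∀ t ∈ U, HasDerivAt (fun u => (4 / 3 : ℂ) * u * s u - 2 * c * L u)
      (2 * s t) t := by
  intro t ht
  have hnhds : U ∈ nhds t := hU.mem_nhds ht
  have dlam := (hlam t ht).hasDerivAt
  have ds := (hs t ht).hasDerivAt
  have dL := (hL t ht).hasDerivAt
  have hcub := hcubic t ht
  have hsqt := hsq t ht
  have hd := hden t ht
  have hs0 : s t ≠ 0 := fun h => hΔ t ht (by rw [← hsqt, h]; ring)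
  have hnum : 2 * lam t - s t ≠ 0 := fun h =>
    Complex.exp_ne_zero (L t) (by rw [hexp t ht, h, zero_div])
  have hlam' : deriv lam t * s t ^ 2 = -lam t := by
    have h1 := (((dlam.pow 3).const_mul 2).add ((hasDerivAt_id t).mul dlam)).add_const c
    have h2 := h1.congr_of_eventuallyEq (f₁ := fun _ => (0 : ℂ))
      (Filter.eventuallyEq_of_mem hnhds fun u hu => by simpa using (hcubic u hu).symm)
    have h3 := h2.unique (hasDerivAt_const t (0 : ℂ))
    norm_num at h3
    linear_combination h3 + deriv lam t * hsqt
  have hs' : 2 * s t * deriv s t = 12 * lam t * deriv lam t + 1 := by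
    have h1 := ((dlam.pow 2).const_mul 6).add (hasDerivAt_id t)
    have h2 := h1.congr_of_eventuallyEq (f₁ := fun u => s u ^ 2)
      (Filter.eventuallyEq_of_mem hnhds fun u hu => by simpa using hsq u hu)
    have h3 := (ds.pow 2).unique h2
    norm_num at h3
    linear_combination h3
  have hL' : deriv L t * (4 * lam t ^ 2 - s t ^ 2)
      = 4 * (deriv lam t * s t - lam t * deriv s t) := by
    have h1 := dL.cexp.mul ((dlam.const_mul 2).add ds)
    have h2 := h1.congr_of_eventuallyEq (f₁ := fun u => 2 * lam u - s u)
      (Filter.eventuallyEq_of_mem hnhds fun u hu => by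
        simp [hexp u hu, div_mul_cancel₀ _ (hden u hu)])
    have h3 := ((dlam.const_mul 2).sub ds).unique h2
    have h4 : Complex.exp (L t) * (2 * lam t + s t) = 2 * lam t - s t := by
      rw [hexp t ht, div_mul_cancel₀ _ hd]
    simp only [Pi.add_apply] at h3
    linear_combination (-(2 * lam t + s t)) * h3
      - (deriv L t * (2 * lam t + s t) + 2 * deriv lam t + deriv s t) * h4
  have es : 2 * s t ^ 3 * deriv s t = s t ^ 2 - 12 * lam t ^ 2 := by
    linear_combination s t ^ 2 * hs' + 12 * lam t * hlam'
  have eL : deriv L t * s t ^ 3 = 6 * lam t := by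
    apply mul_right_cancel₀ (mul_ne_zero hnum hd)
    linear_combination s t ^ 3 * hL' + 4 * s t ^ 2 * hlam' - 2 * lam t * es
  have hmain := (((hasDerivAt_id t).const_mul (4 / 3 : ℂ)).mul ds).sub (dL.const_mul (2 * c))
  refine hmain.congr_deriv ?_
  have hc : c = 4 * lam t ^ 3 - s t ^ 2 * lam t := by
    linear_combination hcub + lam t * hsqt
  have ht' : t = s t ^ 2 - 6 * lam t ^ 2 := by linear_combination -hsqt
  apply mul_right_cancel₀ (pow_ne_zero 3 hs0)
  simp only [id]
  linear_combination (2 / 3 * t) * es - 2 * c * eL - 12 * lam t * hc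
    + 2 / 3 * (s t ^ 2 - 12 * lam t ^ 2) * ht'
end

section
/- Let c ∈ ℂ, R > 0, and let λ : {s ∈ ℂ : |s| > R} → ℂ satisfy 2λ(s)³ + s²·λ(s) + c = 0 for all |s| > R and λ(s)/s → −i/√2 as |s| → ∞. Then there exist R' ≥ R and C > 0 such that for all |s| > R': |λ(s) + (i/√2)·s − c/(2s²) + (3√2·i/8)·c²·s^{−5}| ≤ C·|s|^{−8}. (Writing t = s², this is the asymptotic expansion λ₀(t,c) = −(i/√2)·t^{1/2} + (1/2)·c·t^{−1} − (3√2·i/8)·c²·t^{−5/2} + O(t^{−4}) as t → ∞ along the P-Stokes curve Γ.) -/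
open Complex Filter

/-- The second-order truncation of the root of `2μ³ + μ + u` near a point `a` with `2a² = -1`
solves the cubic up to `O(u³)`, so its distance to any root `μ` is controlled by `u³`. -/
theorem sub_truncation_mul_eq {a u μ : ℂ} (ha : 2 * a ^ 2 = -1) (hμ : 2 * μ ^ 3 + μ + u = 0) :
    (μ - (a + u / 2 + 3 * a / 4 * u ^ 2)) *
        (2 * (μ ^ 2 + μ * (a + u / 2 + 3 * a / 4 * u ^ 2) +
          (a + u / 2 + 3 * a / 4 * u ^ 2) ^ 2) + 1) =
      -(u ^ 3 * (6 * a * (3 * a / 4 + (3 * a / 4) ^ 2 * u) + 2 * (1 / 2 + 3 * a / 4 * u) ^ 3)) := by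
  linear_combination hμ - (a + 3 * (u / 2 + 3 * a / 4 * u ^ 2)) * ha

/-- Any branch of `2μ³ + μ + u = 0` tending to `a` with `2a² = -1` as `u → 0` agrees with its
second-order truncation up to `O(u³)`. -/
theorem eventually_norm_sub_truncation_le {α : Type*} {l : Filter α} {a : ℂ} {u μ : α → ℂ}
    (ha : 2 * a ^ 2 = -1) (hu : Tendsto u l (nhds 0)) (hμ : Tendsto μ l (nhds a))
    (heq : ∀ᶠ x in l, 2 * μ x ^ 3 + μ x + u x = 0) :
    ∃ B : ℝ, 0 < B ∧ ∀ᶠ x in l,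
      ‖μ x - (a + u x / 2 + 3 * a / 4 * u x ^ 2)‖ ≤ B * ‖u x‖ ^ 3 := by
  have hpair := hu.prodMk_nhds hμ
  have hD : Tendsto (fun x => 2 * (μ x ^ 2 + μ x * (a + u x / 2 + 3 * a / 4 * u x ^ 2) +
      (a + u x / 2 + 3 * a / 4 * u x ^ 2) ^ 2) + 1) l (nhds (-2)) := by
    have hc : Continuous fun z : ℂ × ℂ => 2 * (z.2 ^ 2 +
        z.2 * (a + z.1 / 2 + 3 * a / 4 * z.1 ^ 2) +
        (a + z.1 / 2 + 3 * a / 4 * z.1 ^ 2) ^ 2) + 1 := by fun_prop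
    convert (hc.tendsto (0, a)).comp hpair using 2
    · rfl
    · simp only [zero_div]
      linear_combination (-3) * ha
  have hQ : Tendsto (fun x => 6 * a * (3 * a / 4 + (3 * a / 4) ^ 2 * u x) +
      2 * (1 / 2 + 3 * a / 4 * u x) ^ 3) l (nhds (-2)) := by
    have hc : Continuous fun z : ℂ => 6 * a * (3 * a / 4 + (3 * a / 4) ^ 2 * z) +
        2 * (1 / 2 + 3 * a / 4 * z) ^ 3 := by fun_prop
    convert (hc.tendsto 0).comp hu using 2
    · rfl
    · linear_combination (-9 / 4) * ha
  have hD' := hD.norm.eventually (lt_mem_nhds (show (1 : ℝ) < ‖(-2 : ℂ)‖ by norm_num))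
  have hQ' := hQ.norm.eventually (gt_mem_nhds (show ‖(-2 : ℂ)‖ < (3 : ℝ) by norm_num))
  refine ⟨3, by norm_num, ?_⟩
  filter_upwards [heq, hD', hQ'] with x hx hDx hQx
  have h := congrArg norm (sub_truncation_mul_eq ha hx)
  rw [norm_mul, norm_neg, norm_mul, norm_pow] at h
  calc _ ≤ _ := le_mul_of_one_le_right (norm_nonneg _) hDx.le
    _ = _ := h
    _ ≤ ‖u x‖ ^ 3 * 3 := by gcongr
    _ = _ := mul_comm _ _

/-- Asymptotic expansion of `λ₀` along the `P`-Stokes curve: writing `t = s²`,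
the branch of `2λ³ + tλ + c = 0` with `λ(s)/s → −i/√2` satisfies
`λ₀ = −(i/√2)·t^{1/2} + (1/2)·c·t⁻¹ − (3√2·i/8)·c²·t^{−5/2} + O(t⁻⁴)`. -/
theorem lambda_zero_asymptotics (c : ℂ) (R : ℝ) (hR : 0 < R) (lam : ℂ → ℂ)
    (hcubic : ∀ s : ℂ, R < ‖s‖ → 2 * lam s ^ 3 + s ^ 2 * lam s + c = 0)
    (hlim : Tendsto (fun s : ℂ => lam s / s)
      (Filter.comap (fun s : ℂ => ‖s‖) Filter.atTop)
      (nhds (-(Complex.I / (Real.sqrt 2 : ℂ))))) :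
    ∃ R' : ℝ, R ≤ R' ∧ ∃ C : ℝ, 0 < C ∧ ∀ s : ℂ, R' < ‖s‖ →
      ‖lam s + (Complex.I / (Real.sqrt 2 : ℂ)) * s - c / (2 * s ^ 2) +
        (3 * (Real.sqrt 2 : ℂ) * Complex.I / 8) * c ^ 2 / s ^ 5‖ ≤
        C / ‖s‖ ^ 8 := by
  have h2 : (Real.sqrt 2 : ℂ) ^ 2 = 2 := by
    rw [← ofReal_pow, Real.sq_sqrt zero_le_two, ofReal_ofNat]
  have h0 : (Real.sqrt 2 : ℂ) ≠ 0 := fun h => by simp [h] at h2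
  have ha : 2 * (-(I / (Real.sqrt 2 : ℂ))) ^ 2 = -1 := by
    rw [neg_sq, div_pow, h2, I_sq]
    norm_num
  have hu : Tendsto (fun s : ℂ => c / s ^ 3) (comap (fun s : ℂ => ‖s‖) atTop) (nhds 0) := by
    have hinv : Tendsto (fun s : ℂ => s⁻¹) (comap (fun s : ℂ => ‖s‖) atTop) (nhds 0) := by
      rw [comap_norm_atTop]
      exact tendsto_inv₀_cobounded
    simpa [div_eq_mul_inv] using (hinv.pow 3).const_mul c
  have heq : ∀ᶠ s : ℂ in comap (fun s : ℂ => ‖s‖) atTop,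
      2 * (lam s / s) ^ 3 + lam s / s + c / s ^ 3 = 0 := by
    filter_upwards [tendsto_comap.eventually (eventually_gt_atTop R)] with s hs
    have hs0 : s ≠ 0 := norm_pos_iff.mp (hR.trans hs)
    have hsc := hcubic s hs
    field_simp
    linear_combination hsc
  obtain ⟨B, hB, hev⟩ := eventually_norm_sub_truncation_le ha hu hlim heq
  rw [eventually_comap, eventually_atTop] at hev
  obtain ⟨M, hM⟩ := hev
  refine ⟨max R M, le_max_left _ _, B * ‖c‖ ^ 3 + 1, by positivity, fun s hs => ?_⟩
  have hspos : 0 < ‖s‖ := hR.trans ((le_max_left _ _).trans_lt hs)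
  have hs0 : s ≠ 0 := norm_pos_iff.mp hspos
  have hb := hM ‖s‖ ((le_max_right _ _).trans hs.le) s rfl
  have hinv : I / (Real.sqrt 2 : ℂ) = Real.sqrt 2 * I / 2 := by
    field_simp
    linear_combination -h2
  have hfac : lam s + (I / (Real.sqrt 2 : ℂ)) * s - c / (2 * s ^ 2) +
      (3 * (Real.sqrt 2 : ℂ) * I / 8) * c ^ 2 / s ^ 5 =
      s * (lam s / s - (-(I / (Real.sqrt 2 : ℂ)) + c / s ^ 3 / 2 +
        3 * -(I / (Real.sqrt 2 : ℂ)) / 4 * (c / s ^ 3) ^ 2)) := by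
    rw [hinv]
    field_simp
    ring
  rw [hfac, norm_mul]
  calc _ ≤ ‖s‖ * (B * ‖c / s ^ 3‖ ^ 3) := by gcongr
    _ = B * ‖c‖ ^ 3 / ‖s‖ ^ 8 := by
      rw [norm_div, norm_pow]
      field_simp
    _ ≤ _ := by gcongr; linarith
end

section
/- Let c ∈ ℂ, R > 0, let λ : {s ∈ ℂ : |s| > R} → ℂ satisfy 2λ(s)³ + s²·λ(s) + c = 0 for all |s| > R and λ(s)/s → −i/√2 as |s| → ∞, and let w : {s ∈ ℂ : |s| > R} → ℂ satisfy w(s)² = 6λ(s)² + s² and w(s)/s → −√2·i as |s| → ∞. Then there exist R' ≥ R and C > 0 such that for all |s| > R': |w(s) + √2·i·s − (3/2)·c·s^{−2} + (21√2·i/16)·c²·s^{−5}| ≤ C·|s|^{−8}. (Writing t = s², this is the asymptotic expansion R_{−1} = √Δ = −√2·i·t^{1/2} + (3/2)·c·t^{−1} − (21√2·i/16)·c²·t^{−5/2} + O(t^{−4}) along the P-Stokes curve Γ, whose sign is ⊖.) -/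
open Complex Filter

/-- Near `(δ, y) = (0, a)` with `a² = -2`, if `y² = 6 (a / 2 + δ)² + 1` and
`e = 2 δ - 3 a δ² - 2 δ³`, then `y = a + (3/2) e + (21/16) a e² + O(e³)`. -/
lemma eventually_norm_sub_quadratic_le {α : Type*} {l : Filter α} {a : ℂ} (ha : a ^ 2 = -2)
    {d y e : α → ℂ} (hd : Tendsto d l (nhds 0)) (hy : Tendsto y l (nhds a))
    (hsq : ∀ᶠ s in l, y s ^ 2 = 6 * (a / 2 + d s) ^ 2 + 1)
    (he : ∀ᶠ s in l, e s = d s * (2 - 3 * a * d s - 2 * d s ^ 2)) :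
    ∃ K : ℝ, 0 < K ∧ ∀ᶠ s in l,
      ‖y s - (a + 3 / 2 * e s + 21 / 16 * a * e s ^ 2)‖ ≤ K * ‖e s‖ ^ 3 := by
  have ha0 : a ≠ 0 := by
    rintro rfl
    norm_num at ha
  let D : ℂ → ℂ := fun z => 2 - 3 * a * z - 2 * z ^ 2
  let P : ℂ → ℂ := fun z => a + 3 / 2 * (z * D z) + 21 / 16 * a * (z * D z) ^ 2
  let p : ℂ → ℂ := fun z => 57 / 2 + 21 / 16 * (-26 * a * z - 24 * z ^ 2 + 4 * a * z ^ 3)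
  let Q : ℂ → ℂ := fun z => -(9 / 2 * a - 9 / 8 * z
    + 2 * (a + 3 * z + 3 / 4 * a * z ^ 2) * p z + z ^ 3 * p z ^ 2)
  have hD : Tendsto (fun s => D (d s)) l (nhds (D 0)) :=
    ((by fun_prop : Continuous D).tendsto 0).comp hd
  have hP : Tendsto (fun s => P (d s)) l (nhds (P 0)) :=
    ((by fun_prop : Continuous P).tendsto 0).comp hd
  have hQ : Tendsto (fun s => Q (d s)) l (nhds (Q 0)) :=
    ((by fun_prop : Continuous Q).tendsto 0).comp hd
  have hD0 : D 0 ≠ 0 := by simp [D]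
  have hyP0 : a + P 0 ≠ 0 := by
    have : a + P 0 = 2 * a := by simp only [P]; ring
    rw [this]
    exact mul_ne_zero two_ne_zero ha0
  have hyP := hy.add hP
  have hG := (hQ.div ((hD.pow 3).mul hyP) (mul_ne_zero (pow_ne_zero 3 hD0) hyP0)).norm
  set L := ‖Q 0 / (D 0 ^ 3 * (a + P 0))‖
  refine ⟨L + 1, by positivity, ?_⟩
  filter_upwards [hsq, he, hD.eventually_ne hD0, hyP.eventually_ne hyP0,
    hG.eventually (gt_mem_nhds (lt_add_one L))] with s h1 h2 h3 h4 h5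
  have hPe : a + 3 / 2 * e s + 21 / 16 * a * e s ^ 2 = P (d s) := by
    rw [h2]
  have key : (y s - P (d s)) * (y s + P (d s)) = d s ^ 3 * Q (d s) := by
    have hPp : P (d s) = a + 3 * d s + 3 / 4 * a * d s ^ 2 + d s ^ 3 * p (d s) := by
      simp only [P, p, D]
      linear_combination
        (-63 / 4 * d s ^ 3 + 189 / 16 * a * d s ^ 4 + 63 / 4 * d s ^ 5) * ha
    rw [hPp]
    simp only [Q]
    linear_combination h1 + (1 / 2 - 3 / 2 * d s ^ 2 - 9 / 16 * d s ^ 4) * ha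
  have hrepr : y s - P (d s) = Q (d s) / (D (d s) ^ 3 * (y s + P (d s))) * e s ^ 3 := by
    have h2' : e s = d s * D (d s) := h2
    rw [h2']
    field_simp
    linear_combination key
  rw [hPe, hrepr, norm_mul, norm_pow]
  gcongr
  exact h5.le

/-- Asymptotic expansion of `R₋₁ = √Δ` along the `P`-Stokes curve `Γ` (of sign
`⊖`): writing `t = s²`, with `λ` the branch of `2λ³ + tλ + c = 0` with
`λ(s)/s → −i/√2` and `w` the branch of `w² = Δ = 6λ² + t` with `w(s)/s → −√2·i`,
one has `R₋₁ = −√2·i·t^{1/2} + (3/2)·c·t⁻¹ − (21√2·i/16)·c²·t^{−5/2} + O(t⁻⁴)`. -/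
theorem R_neg_one_asymptotics (c : ℂ) (R : ℝ) (hR : 0 < R) (lam w : ℂ → ℂ)
    (hcubic : ∀ s : ℂ, R < ‖s‖ → 2 * lam s ^ 3 + s ^ 2 * lam s + c = 0)
    (hlim : Tendsto (fun s : ℂ => lam s / s)
      (Filter.comap (fun s : ℂ => ‖s‖) Filter.atTop)
      (nhds (-(Complex.I / (Real.sqrt 2 : ℂ)))))
    (hwsq : ∀ s : ℂ, R < ‖s‖ → w s ^ 2 = 6 * lam s ^ 2 + s ^ 2)
    (hwlim : Tendsto (fun s : ℂ => w s / s)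
      (Filter.comap (fun s : ℂ => ‖s‖) Filter.atTop)
      (nhds (-((Real.sqrt 2 : ℂ) * Complex.I)))) :
    ∃ R' : ℝ, R ≤ R' ∧ ∃ C : ℝ, 0 < C ∧ ∀ s : ℂ, R' < ‖s‖ →
      ‖w s + (Real.sqrt 2 : ℂ) * Complex.I * s - (3 / 2 : ℂ) * c / s ^ 2 +
        (21 * (Real.sqrt 2 : ℂ) * Complex.I / 16) * c ^ 2 / s ^ 5‖ ≤
        C / ‖s‖ ^ 8 := by
  set l : Filter ℂ := Filter.comap (fun s : ℂ => ‖s‖) Filter.atTop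
  have htend : Tendsto (fun s : ℂ => ‖s‖) l atTop := tendsto_comap
  have hr2 : (Real.sqrt 2 : ℂ) ^ 2 = 2 := by
    rw [← Complex.ofReal_pow, Real.sq_sqrt (by norm_num)]
    norm_num
  have hr0 : (Real.sqrt 2 : ℂ) ≠ 0 := by
    intro h
    rw [h] at hr2
    norm_num at hr2
  have ha : (-((Real.sqrt 2 : ℂ) * Complex.I)) ^ 2 = -2 := by
    rw [neg_sq, mul_pow, hr2, Complex.I_sq]
    norm_num
  have hhalf : -(Complex.I / (Real.sqrt 2 : ℂ)) = -((Real.sqrt 2 : ℂ) * Complex.I) / 2 := by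
    field_simp
    linear_combination hr2
  rw [hhalf] at hlim
  set a : ℂ := -((Real.sqrt 2 : ℂ) * Complex.I) with ha_def
  have hd : Tendsto (fun s : ℂ => lam s / s - a / 2) l (nhds 0) := by
    simpa using hlim.sub_const (a / 2)
  have hlarge : ∀ᶠ s in l, R < ‖s‖ := htend.eventually_gt_atTop R
  obtain ⟨K, hK, hev⟩ := eventually_norm_sub_quadratic_le (e := fun s => c / s ^ 3) ha hd hwlim
    (by
      filter_upwards [hlarge] with s hs
      have hs0 : s ≠ 0 := norm_pos_iff.mp (hR.trans hs)
      rw [add_sub_cancel]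
      field_simp
      exact hwsq s hs)
    (by
      filter_upwards [hlarge] with s hs
      have hs0 : s ≠ 0 := norm_pos_iff.mp (hR.trans hs)
      have hx : 2 * (lam s / s) ^ 3 + lam s / s + c / s ^ 3 = 0 := by
        field_simp
        linear_combination hcubic s hs
      generalize lam s / s = x at hx ⊢
      linear_combination hx + (a / 2 - 3 / 2 * x) * ha)
  obtain ⟨M, hM⟩ := (Filter.eventually_atTop.mp (Filter.eventually_comap.mp hev))
  refine ⟨max R M, le_max_left _ _, K * ‖c‖ ^ 3 + 1, by positivity, fun s hs => ?_⟩
  have hspos : 0 < ‖s‖ := hR.trans ((le_max_left _ _).trans_lt hs)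
  have hs0 : s ≠ 0 := norm_pos_iff.mp hspos
  have hb := hM ‖s‖ ((le_max_right _ _).trans hs.le) s rfl
  have hfactor : w s + (Real.sqrt 2 : ℂ) * Complex.I * s - (3 / 2 : ℂ) * c / s ^ 2 +
      (21 * (Real.sqrt 2 : ℂ) * Complex.I / 16) * c ^ 2 / s ^ 5 =
      s * (w s / s - (a + 3 / 2 * (c / s ^ 3) + 21 / 16 * a * (c / s ^ 3) ^ 2)) := by
    rw [ha_def]
    field_simp
    ring
  rw [hfactor, norm_mul]
  calc ‖s‖ * ‖w s / s - (a + 3 / 2 * (c / s ^ 3) + 21 / 16 * a * (c / s ^ 3) ^ 2)‖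
      ≤ ‖s‖ * (K * ‖c / s ^ 3‖ ^ 3) := by gcongr
    _ = K * ‖c‖ ^ 3 / ‖s‖ ^ 8 := by
      rw [norm_div, norm_pow]
      field_simp
    _ ≤ (K * ‖c‖ ^ 3 + 1) / ‖s‖ ^ 8 := by
      gcongr
      linarith
end

section
/- Let c ∈ ℂ, R > 0, and let λ : {s ∈ ℂ : |s| > R} → ℂ satisfy 2λ(s)³ + s²·λ(s) + c = 0 for all |s| > R and λ(s)/s → −i/√2 as |s| → ∞. Then there exist R' ≥ R and C > 0 such that for all |s| > R': 6λ(s)² + s² ≠ 0 and |−λ(s)/(6λ(s)² + s²) + (i/(2√2))·s^{−1} + (1/2)·c·s^{−4} − (15√2·i/16)·c²·s^{−7}| ≤ C·|s|^{−10}. (Writing t = s², this is the asymptotic expansion ν₁^{(0)}(t,c) = −(i/(2√2))·t^{−1/2} − (1/2)·c·t^{−2} + (15√2·i/16)·c²·t^{−7/2} + O(t^{−5}) of the first correction ν₁^{(0)} = dλ₀/dt = −λ₀/Δ of the 0-parameter solution of (H_II).) -/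
open Complex Filter

lemma norm_one_add_small_ge {a y : ℂ} (ha : ‖a‖ ≤ 1) (hy : ‖y‖ ≤ 1 / 16) :
    1 ≤ ‖2 - 6 * a * y - 2 * y ^ 2‖ ∧ 1 ≤ ‖-2 + 12 * a * y + 6 * y ^ 2‖ := by
  have hy0 := norm_nonneg y
  have hay : ‖a * y‖ ≤ 1 / 16 := by
    rw [norm_mul]; nlinarith [norm_nonneg a]
  have hyy : ‖y ^ 2‖ ≤ 1 / 256 := by
    rw [norm_pow]; nlinarith
  constructor
  · have h : ‖(2 : ℂ)‖ ≤ ‖2 - 6 * a * y - 2 * y ^ 2‖ + ‖6 * (a * y)‖ + ‖2 * y ^ 2‖ := by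
      refine le_trans (le_of_eq ?_) norm_add₃_le
      congr 1
      ring
    simp only [norm_mul (6 : ℂ), norm_mul (2 : ℂ), RCLike.norm_ofNat] at h
    linarith
  · have h : ‖(2 : ℂ)‖ ≤ ‖-(-2 + 12 * a * y + 6 * y ^ 2)‖ + ‖12 * (a * y)‖ + ‖6 * y ^ 2‖ := by
      refine le_trans (le_of_eq ?_) norm_add₃_le
      congr 1
      ring
    simp only [norm_neg, norm_mul (12 : ℂ), norm_mul (6 : ℂ), RCLike.norm_ofNat] at h
    linarith

lemma norm_remainder_le {a y : ℂ} (ha : ‖a‖ ≤ 1) (hy : ‖y‖ ≤ 1) :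
    ‖64 - 765 / 2 * (a * y) - 933 / 2 * y ^ 2 + 1155 / 2 * (a * y ^ 3) + 180 * y ^ 4
      - 45 * (a * y ^ 5)‖ ≤ 2000 := by
  have hp (n : ℕ) : ‖y ^ n‖ ≤ 1 := by
    rw [norm_pow]; exact pow_le_one₀ (norm_nonneg y) hy
  have hap (n : ℕ) : ‖a * y ^ n‖ ≤ 1 := by
    rw [norm_mul]; exact mul_le_one₀ ha (norm_nonneg _) (hp n)
  refine (norm_sub_le_of_le (norm_add_le_of_le (norm_add_le_of_le (norm_sub_le_of_le
    (norm_sub_le_of_le (r₁ := 64) (r₂ := 765 / 2) ?_ ?_) (r₂ := 933 / 2) ?_)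
    (r₂ := 1155 / 2) ?_) (r₂ := 180) ?_) (r₂ := 45) ?_).trans (by norm_num)
  · simp
  all_goals
    rw [norm_mul]
    norm_num
  · simpa using hap 1
  · simpa using hp 2
  · simpa using hap 3
  · simpa using hp 4
  · simpa using hap 5

/-- Expansion of `-x / (6 * x ^ 2 + 1)` to second order in `e`, for the root `x` of
`2 * x ^ 3 + x + e = 0`
close to a square root `a` of `-1/2`. -/
lemma norm_reduced_expansion_le {a x e : ℂ} (ha2 : a ^ 2 = -1 / 2) (ha : ‖a‖ ≤ 1)
    (hx : ‖x - a‖ ≤ 1 / 16) (he : 2 * x ^ 3 + x + e = 0) :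
    6 * x ^ 2 + 1 ≠ 0 ∧
      ‖-x / (6 * x ^ 2 + 1) - a / 2 + e / 2 + 15 * a / 8 * e ^ 2‖ ≤ 2000 * ‖e‖ ^ 3 := by
  obtain ⟨y, rfl⟩ : ∃ y, x = a + y := ⟨x - a, by ring⟩
  rw [add_sub_cancel_left] at hx
  obtain ⟨h1, h2⟩ := norm_one_add_small_ge ha hx
  have hG := norm_remainder_le ha (hx.trans (by norm_num))
  have hey : e = y * (2 - 6 * a * y - 2 * y ^ 2) := by
    linear_combination he - (2 * a + 6 * y) * ha2
  have hye : ‖y‖ ≤ ‖e‖ := by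
    rw [hey, norm_mul]; exact le_mul_of_one_le_right (norm_nonneg y) h1
  have hQ : 6 * (a + y) ^ 2 + 1 = -2 + 12 * a * y + 6 * y ^ 2 := by
    linear_combination 6 * ha2
  have hQ0 : -2 + 12 * a * y + 6 * y ^ 2 ≠ 0 := norm_pos_iff.1 (by linarith)
  rw [hQ]
  refine ⟨hQ0, ?_⟩
  have key : -(a + y) / (-2 + 12 * a * y + 6 * y ^ 2) - a / 2 + e / 2 + 15 * a / 8 * e ^ 2 =
      -(y ^ 3 * (64 - 765 / 2 * (a * y) - 933 / 2 * y ^ 2 + 1155 / 2 * (a * y ^ 3) + 180 * y ^ 4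
        - 45 * (a * y ^ 5))) / (-2 + 12 * a * y + 6 * y ^ 2) := by
    rw [eq_div_iff hQ0]
    have hd := div_mul_cancel₀ (-(a + y)) hQ0
    rw [hey]
    linear_combination hd + (-6 * y + 144 * y ^ 3 - 945 * y ^ 5 + 360 * y ^ 7 - 675 * a * y ^ 4
      + 945 * a * y ^ 6 + 810 * a ^ 2 * y ^ 5) * ha2
  rw [key, norm_div, norm_neg, norm_mul, norm_pow]
  refine (div_le_self (by positivity) h2).trans ?_
  rw [mul_comm]
  gcongr


/-- Asymptotic expansion of `ν₁⁽⁰⁾ = dλ₀/dt = −λ₀/Δ`: writing `t = s²`, with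
`λ` the branch of `2λ³ + tλ + c = 0` with `λ(s)/s → −i/√2`, one has
`ν₁⁽⁰⁾ = −(i/(2√2))·t^{−1/2} − (1/2)·c·t⁻² + (15√2·i/16)·c²·t^{−7/2} + O(t⁻⁵)`. -/
theorem nu_one_asymptotics (c : ℂ) (R : ℝ) (hR : 0 < R) (lam : ℂ → ℂ)
    (hcubic : ∀ s : ℂ, R < ‖s‖ → 2 * lam s ^ 3 + s ^ 2 * lam s + c = 0)
    (hlim : Tendsto (fun s : ℂ => lam s / s)
      (Filter.comap (fun s : ℂ => ‖s‖) Filter.atTop)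
      (nhds (-(Complex.I / (Real.sqrt 2 : ℂ))))) :
    ∃ R' : ℝ, R ≤ R' ∧ ∃ C : ℝ, 0 < C ∧ ∀ s : ℂ, R' < ‖s‖ →
      6 * lam s ^ 2 + s ^ 2 ≠ 0 ∧
      ‖-(lam s) / (6 * lam s ^ 2 + s ^ 2) +
        (Complex.I / (2 * (Real.sqrt 2 : ℂ))) / s + (1 / 2 : ℂ) * c / s ^ 4 -
        (15 * (Real.sqrt 2 : ℂ) * Complex.I / 16) * c ^ 2 / s ^ 7‖ ≤
        C / ‖s‖ ^ 10 := by
  have h2 : (Real.sqrt 2 : ℂ) ^ 2 = 2 := by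
    exact_mod_cast Real.sq_sqrt (show (0 : ℝ) ≤ 2 by norm_num)
  have h20 : (Real.sqrt 2 : ℂ) ≠ 0 := by
    intro h; simp [h] at h2
  set a : ℂ := -(Complex.I / (Real.sqrt 2 : ℂ)) with ha_def
  have ha2 : a ^ 2 = -1 / 2 := by
    rw [ha_def, neg_sq, div_pow, h2, Complex.I_sq]
  have ha : ‖a‖ ≤ 1 := by
    have h : ‖a‖ ^ 2 = 1 / 2 := by rw [← norm_pow, ha2]; norm_num
    nlinarith [norm_nonneg a]
  have hI1 : Complex.I / (2 * (Real.sqrt 2 : ℂ)) = -a / 2 := by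
    rw [ha_def]; field_simp
  have hI2 : 15 * (Real.sqrt 2 : ℂ) * Complex.I / 16 = -(15 * a / 8) := by
    rw [ha_def]; field_simp; rw [h2]; norm_num
  have hclose := hlim.eventually (Metric.closedBall_mem_nhds a (show (0 : ℝ) < 1 / 16 by norm_num))
  obtain ⟨M, hM⟩ := eventually_atTop.1 (eventually_comap.1 hclose)
  refine ⟨max R M, le_max_left _ _, 2000 * ‖c‖ ^ 3 + 1, by positivity, fun s hs => ?_⟩
  have hsR : R < ‖s‖ := (le_max_left _ _).trans_lt hs
  have hs0 : s ≠ 0 := norm_pos_iff.1 (hR.trans hsR)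
  have hx : ‖lam s / s - a‖ ≤ 1 / 16 := by
    simpa [dist_eq_norm] using hM ‖s‖ ((le_max_right _ _).trans hs.le) s rfl
  have he : 2 * (lam s / s) ^ 3 + lam s / s + c / s ^ 3 = 0 := by
    have h := hcubic s hsR
    field_simp
    linear_combination h
  obtain ⟨hne, hbound⟩ := norm_reduced_expansion_le ha2 ha hx he
  have hD : 6 * lam s ^ 2 + s ^ 2 = s ^ 2 * (6 * (lam s / s) ^ 2 + 1) := by
    field_simp
  refine ⟨hD ▸ mul_ne_zero (pow_ne_zero 2 hs0) hne, ?_⟩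
  have hlead : -(lam s) / (6 * lam s ^ 2 + s ^ 2) =
      -(lam s / s) / (6 * (lam s / s) ^ 2 + 1) / s := by
    rw [hD, div_div, div_eq_div_iff (mul_ne_zero (pow_ne_zero 2 hs0) hne) (mul_ne_zero hne hs0)]
    field_simp
  have hscale : -(lam s) / (6 * lam s ^ 2 + s ^ 2) + -a / 2 / s + (1 / 2 : ℂ) * c / s ^ 4 -
      -(15 * a / 8) * c ^ 2 / s ^ 7 =
      (-(lam s / s) / (6 * (lam s / s) ^ 2 + 1) - a / 2 + c / s ^ 3 / 2 +
        15 * a / 8 * (c / s ^ 3) ^ 2) / s := by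
    rw [hlead]
    generalize -(lam s / s) / (6 * (lam s / s) ^ 2 + 1) = z
    field_simp
    ring
  rw [hI1, hI2, hscale, norm_div]
  have hspos : 0 < ‖s‖ := norm_pos_iff.2 hs0
  calc _ ≤ 2000 * ‖c / s ^ 3‖ ^ 3 / ‖s‖ := by gcongr
    _ = 2000 * ‖c‖ ^ 3 / ‖s‖ ^ 10 := by
      rw [norm_div, norm_pow]; field_simp
    _ ≤ _ := by gcongr; linarith
end

section
/- Let c ∈ ℂ, R > 0, and let λ : {s ∈ ℂ : |s| > R} → ℂ satisfy 2λ(s)³ + s²·λ(s) + c = 0 for all |s| > R and λ(s)/s → −i/√2 as |s| → ∞. Then there exist R' ≥ R and C > 0 such that for all |s| > R': 6λ(s)² + s² ≠ 0 and |(6λ(s)² − s²)/(4·(6λ(s)² + s²)²) + (1/4)·s^{−2} − (9√2·i/16)·c·s^{−5}| ≤ C·|s|^{−8}. (Writing t = s², this is the asymptotic expansion R₀(t,c) = −(1/4)·t^{−1} + (9√2·i/16)·c·t^{−5/2} + O(t^{−4}) of the WKB coefficient R₀ = −(1/2)·(d/dt log R_{−1}) = (6λ₀² − t)/(4Δ²).)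 -/
open Complex Filter

/-- The second-order remainder of `(6w² − 1)/(4(6w² + 1)²)` at a point `a` with `2a² + 1 = 0`,
divided by the square of `2w³ + w`. -/
noncomputable def cubicRemainder (a w : ℂ) : ℂ :=
  9 / 8 / w * (2 / (w + a) + a * (12 - 9 * (2 * w ^ 2 + 1))) / (6 * w ^ 2 + 1) ^ 2

theorem continuousAt_cubicRemainder {a : ℂ} (ha : 2 * a ^ 2 + 1 = 0) :
    ContinuousAt (cubicRemainder a) a := by
  have h0 : a ≠ 0 := by
    rintro rfl
    norm_num at ha
  have h1 : a + a ≠ 0 := by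
    rw [← two_mul]
    exact mul_ne_zero two_ne_zero h0
  have h2 : (6 * a ^ 2 + 1) ^ 2 ≠ 0 := by
    have h : 6 * a ^ 2 + 1 = -2 := by linear_combination 3 * ha
    rw [h]
    norm_num
  unfold cubicRemainder
  fun_prop (disch := assumption)

theorem rational_expansion_of_cubic {a w e : ℂ} (ha : 2 * a ^ 2 + 1 = 0)
    (hw : 2 * w ^ 3 + w + e = 0) (h0 : w ≠ 0) (h1 : w + a ≠ 0) (h2 : 6 * w ^ 2 + 1 ≠ 0) :
    (6 * w ^ 2 - 1) / (4 * (6 * w ^ 2 + 1) ^ 2) + 1 / 4 + 9 / 8 * a * e =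
      e ^ 2 * cubicRemainder a w := by
  have he : e = -(w * (2 * w ^ 2 + 1)) := by linear_combination hw
  have hu : (2 * w ^ 2 + 1) * (2 / (w + a)) = 4 * (w - a) := by
    field_simp
    linear_combination 2 * ha
  have key : e ^ 2 * cubicRemainder a w = 9 / 8 * w * (2 * w ^ 2 + 1) *
      (4 * (w - a) + (2 * w ^ 2 + 1) * (a * (12 - 9 * (2 * w ^ 2 + 1)))) /
        (6 * w ^ 2 + 1) ^ 2 := by
    rw [← hu, he, cubicRemainder]
    generalize 2 / (w + a) = q
    field_simp
  rw [key, he]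
  field_simp
  ring

/-- Asymptotic expansion of `R₀ = (6λ₀² − t)/(4Δ²)`: writing `t = s²`, with
`λ` the branch of `2λ³ + tλ + c = 0` with `λ(s)/s → −i/√2`, one has
`R₀ = −(1/4)·t⁻¹ + (9√2·i/16)·c·t^{−5/2} + O(t⁻⁴)`. -/
theorem R_zero_asymptotics (c : ℂ) (R : ℝ) (hR : 0 < R) (lam : ℂ → ℂ)
    (hcubic : ∀ s : ℂ, R < ‖s‖ → 2 * lam s ^ 3 + s ^ 2 * lam s + c = 0)
    (hlim : Tendsto (fun s : ℂ => lam s / s)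
      (Filter.comap (fun s : ℂ => ‖s‖) Filter.atTop)
      (nhds (-(Complex.I / (Real.sqrt 2 : ℂ))))) :
    ∃ R' : ℝ, R ≤ R' ∧ ∃ C : ℝ, 0 < C ∧ ∀ s : ℂ, R' < ‖s‖ →
      6 * lam s ^ 2 + s ^ 2 ≠ 0 ∧
      ‖(6 * lam s ^ 2 - s ^ 2) / (4 * (6 * lam s ^ 2 + s ^ 2) ^ 2) +
        (1 / 4 : ℂ) / s ^ 2 -
        (9 * (Real.sqrt 2 : ℂ) * Complex.I / 16) * c / s ^ 5‖ ≤
        C / ‖s‖ ^ 8 := by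
  set a : ℂ := -(I / (Real.sqrt 2 : ℂ)) with ha_def
  have hsq : (Real.sqrt 2 : ℂ) ^ 2 = 2 := by
    exact_mod_cast Real.sq_sqrt (by norm_num : (0 : ℝ) ≤ 2)
  have hs0 : (Real.sqrt 2 : ℂ) ≠ 0 := by
    intro h
    rw [h] at hsq
    norm_num at hsq
  have ha : 2 * a ^ 2 + 1 = 0 := by
    rw [ha_def, neg_sq, div_pow, hsq, I_sq]
    norm_num
  have hcoef : (Real.sqrt 2 : ℂ) * I = -2 * a := by
    rw [ha_def]
    field_simp
    linear_combination hsq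
  have ha0 : a ≠ 0 := by
    intro h
    rw [h] at ha
    norm_num at ha
  have e0 : ∀ᶠ w in nhds a, w ≠ 0 := continuousAt_id.eventually_ne ha0
  have e1 : ∀ᶠ w in nhds a, w + a ≠ 0 := by
    refine ContinuousAt.eventually_ne (by fun_prop) ?_
    rw [← two_mul]
    exact mul_ne_zero two_ne_zero ha0
  have e2 : ∀ᶠ w in nhds a, 6 * w ^ 2 + 1 ≠ 0 := by
    refine ContinuousAt.eventually_ne (by fun_prop) ?_
    have h : 6 * a ^ 2 + 1 = -2 := by linear_combination 3 * ha
    rw [h]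
    norm_num
  have e3 : ∀ᶠ w in nhds a, ‖cubicRemainder a w‖ < ‖cubicRemainder a a‖ + 1 :=
    (continuousAt_cubicRemainder ha).norm.eventually_lt_const (lt_add_one _)
  have hev := hlim.eventually (e0.and (e1.and (e2.and e3)))
  rw [eventually_comap] at hev
  obtain ⟨M, hM⟩ := eventually_atTop.mp hev
  refine ⟨max R M, le_max_left _ _, (‖cubicRemainder a a‖ + 1) * ‖c‖ ^ 2 + 1, by positivity, ?_⟩
  intro s hs
  have hRs : R < ‖s‖ := (le_max_left _ _).trans_lt hs
  obtain ⟨h0, h1, h2, h3⟩ := hM ‖s‖ ((le_max_right _ _).trans hs.le) s rfl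
  have hspos : 0 < ‖s‖ := hR.trans hRs
  have hsne : s ≠ 0 := norm_pos_iff.mp hspos
  obtain ⟨w, hw⟩ : ∃ w, lam s / s = w := ⟨_, rfl⟩
  rw [hw] at h0 h1 h2 h3
  have hlam : lam s = w * s := by rw [← hw, div_mul_cancel₀ _ hsne]
  have hc := hcubic s hRs
  rw [hlam] at hc ⊢
  have hwe : 2 * w ^ 3 + w + c / s ^ 3 = 0 := by
    field_simp
    linear_combination hc
  have hfac : 6 * (w * s) ^ 2 + s ^ 2 = s ^ 2 * (6 * w ^ 2 + 1) := by ring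
  have hexp := rational_expansion_of_cubic ha hwe h0 h1 h2
  have hmain : (6 * (w * s) ^ 2 - s ^ 2) / (4 * (6 * (w * s) ^ 2 + s ^ 2) ^ 2) +
        (1 / 4 : ℂ) / s ^ 2 - (9 * (Real.sqrt 2 : ℂ) * I / 16) * c / s ^ 5 =
      cubicRemainder a w * c ^ 2 / s ^ 8 := by
    calc _ = ((6 * w ^ 2 - 1) / (4 * (6 * w ^ 2 + 1) ^ 2) + 1 / 4 +
          9 / 8 * a * (c / s ^ 3)) / s ^ 2 := by
          rw [hfac, mul_assoc 9, hcoef]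
          field_simp
          ring
      _ = _ := by
          rw [hexp]
          field_simp
  refine ⟨?_, ?_⟩
  · rw [hfac]
    exact mul_ne_zero (pow_ne_zero 2 hsne) h2
  · rw [hmain, norm_div, norm_mul, norm_pow, norm_pow]
    gcongr
    nlinarith [mul_le_mul_of_nonneg_right h3.le (sq_nonneg ‖c‖)]
end

section
/- Let c ∈ ℂ, R > 0, and let λ : {s ∈ ℂ : |s| > R} → ℂ satisfy 2λ(s)³ + s²·λ(s) + c = 0 for all |s| > R and λ(s)/s → −i/√2 as |s| → ∞. Then there exist R' ≥ R and C > 0 such that for all |s| > R': 6λ(s)² + s² ≠ 0 and |2·λ(s)·s²/(6λ(s)² + s²)⁴ + (√2·i/16)·s^{−5}| ≤ C·|s|^{−8}. (Writing t = s², this is the asymptotic expansion λ₂^{(0)}(t,c) = −(√2·i/16)·t^{−5/2} + O(t^{−4}) of the second coefficient λ₂^{(0)} = λ₀''/Δ = 2λ₀t/Δ⁴ of the 0-parameter solution of (P_II).) -/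
open Complex Filter

/-- If `u` is closer to `a` than to the other roots of `2u³ + u`, where `2a² + 1 = 0`, then
`u` differs from `a` by at most the perturbation of the cubic. -/
lemma norm_sub_le_of_cubic {a u e : ℂ} (ha : 2 * a ^ 2 + 1 = 0)
    (hu : 2 * u ^ 3 + u + e = 0) (hfar : 1 ≤ ‖2 * u * (u + a)‖) : ‖u - a‖ ≤ ‖e‖ := by
  have hprod : 2 * u * (u + a) * (u - a) = -e := by
    linear_combination hu - u * ha
  calc ‖u - a‖ ≤ ‖2 * u * (u + a)‖ * ‖u - a‖ :=
        le_mul_of_one_le_left (norm_nonneg _) hfar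
    _ = ‖e‖ := by rw [← norm_mul, hprod, norm_neg]

/-- Asymptotic expansion of `λ₂⁽⁰⁾ = 2λ₀t/Δ⁴`: writing `t = s²`, with `λ` the
branch of `2λ³ + tλ + c = 0` with `λ(s)/s → −i/√2`, one has
`λ₂⁽⁰⁾ = −(√2·i/16)·t^{−5/2} + O(t⁻⁴)`. -/
theorem lambda_two_asymptotics (c : ℂ) (R : ℝ) (hR : 0 < R) (lam : ℂ → ℂ)
    (hcubic : ∀ s : ℂ, R < ‖s‖ → 2 * lam s ^ 3 + s ^ 2 * lam s + c = 0)
    (hlim : Tendsto (fun s : ℂ => lam s / s)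
      (Filter.comap (fun s : ℂ => ‖s‖) Filter.atTop)
      (nhds (-(Complex.I / (Real.sqrt 2 : ℂ))))) :
    ∃ R' : ℝ, R ≤ R' ∧ ∃ C : ℝ, 0 < C ∧ ∀ s : ℂ, R' < ‖s‖ →
      6 * lam s ^ 2 + s ^ 2 ≠ 0 ∧
      ‖2 * lam s * s ^ 2 / (6 * lam s ^ 2 + s ^ 2) ^ 4 +
        ((Real.sqrt 2 : ℂ) * Complex.I / 16) / s ^ 5‖ ≤
        C / ‖s‖ ^ 8 := by
  set a : ℂ := -(Complex.I / (Real.sqrt 2 : ℂ)) with ha_def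
  have hsqrt : (Real.sqrt 2 : ℂ) ^ 2 = 2 := by
    rw [← Complex.ofReal_pow, Real.sq_sqrt (by norm_num)]
    norm_num
  have hsqrt0 : (Real.sqrt 2 : ℂ) ≠ 0 := by
    intro h
    simp [h] at hsqrt
  have ha : 2 * a ^ 2 + 1 = 0 := by
    rw [ha_def, neg_sq, div_pow, hsqrt, Complex.I_sq]
    norm_num
  have hden : 6 * a ^ 2 + 1 = -2 := by linear_combination 3 * ha
  set g : ℂ → ℂ := fun u => 2 * u / (6 * u ^ 2 + 1) ^ 4 with hg
  have hga : g a = -((Real.sqrt 2 : ℂ) * Complex.I / 16) := by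
    simp only [hg]
    rw [hden, ha_def]
    field_simp
    linear_combination 8 * hsqrt
  have hdiff : DifferentiableAt ℂ g a := by
    have h0 : (6 * a ^ 2 + 1) ^ 4 ≠ 0 := by rw [hden]; norm_num
    fun_prop (disch := exact h0)
  obtain ⟨K, hK, hKbound⟩ := hdiff.isBigO_sub.exists_pos
  have hden_ne : ∀ᶠ u in nhds a, 6 * u ^ 2 + 1 ≠ 0 := by
    refine ContinuousAt.eventually_ne (by fun_prop) ?_
    rw [hden]
    norm_num
  have hfar : ∀ᶠ u in nhds a, 1 < ‖2 * u * (u + a)‖ := by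
    have hcont : ContinuousAt (fun u : ℂ => ‖2 * u * (u + a)‖) a := by fun_prop
    refine hcont.eventually_const_lt ?_
    have : 2 * a * (a + a) = -2 := by linear_combination 2 * ha
    simp only [this]
    norm_num
  have hev := hlim.eventually (hKbound.bound.and (hden_ne.and hfar))
  rw [eventually_comap, eventually_atTop] at hev
  obtain ⟨M, hM⟩ := hev
  refine ⟨max R M, le_max_left _ _, K * ‖c‖ + 1, by positivity, fun s hs => ?_⟩
  have hsR : R < ‖s‖ := (le_max_left _ _).trans_lt hs
  obtain ⟨hbound, hne, hlt⟩ := hM ‖s‖ ((le_max_right _ _).trans hs.le) s rfl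
  have hs0 : s ≠ 0 := norm_pos_iff.mp (hR.trans hsR)
  have hspos : 0 < ‖s‖ := hR.trans hsR
  set u : ℂ := lam s / s with hu_def
  have hlam : lam s = u * s := by rw [hu_def, div_mul_cancel₀ _ hs0]
  have hcub : 2 * u ^ 3 + u + c / s ^ 3 = 0 := by
    have h := hcubic s hsR
    rw [hlam] at h
    field_simp
    linear_combination h
  have hclose := norm_sub_le_of_cubic ha hcub hlt.le
  have hΔ : 6 * lam s ^ 2 + s ^ 2 = (6 * u ^ 2 + 1) * s ^ 2 := by
    rw [hlam]
    ring
  refine ⟨hΔ ▸ mul_ne_zero hne (pow_ne_zero 2 hs0), ?_⟩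
  have hexpr : 2 * lam s * s ^ 2 / (6 * lam s ^ 2 + s ^ 2) ^ 4 +
      ((Real.sqrt 2 : ℂ) * Complex.I / 16) / s ^ 5 = (g u - g a) / s ^ 5 := by
    rw [hΔ, hga, hlam]
    simp only [hg]
    field_simp
    ring
  rw [hexpr, norm_div, norm_pow]
  rw [norm_div, norm_pow] at hclose
  calc ‖g u - g a‖ / ‖s‖ ^ 5 ≤ K * (‖c‖ / ‖s‖ ^ 3) / ‖s‖ ^ 5 := by
        gcongr
        exact hbound.trans (by gcongr)
    _ = K * ‖c‖ / ‖s‖ ^ 8 := by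
        field_simp
    _ ≤ (K * ‖c‖ + 1) / ‖s‖ ^ 8 := by
        gcongr
        linarith
end

section
/- Let η, c ∈ ℂ, let U ⊆ ℂ be open, let λ : U → ℂ be any function, and let λ₀, L, W : U → ℂ be differentiable functions such that for every t ∈ U: 2λ₀(t)³ + t·λ₀(t) + c = 0, 6λ₀(t)² + t ≠ 0, 2λ₀(t)² + t ≠ 0, exp(L(t)) = −(2λ₀(t)² + t)/4, and W has derivative η·(λ(t) − λ₀(t)) at t. Then for every t ∈ U the function t ↦ (4/3)·η·λ₀(t)³ + c·η·L(t) − W(t) has derivative −η·λ(t) at t. (This verifies the paper's claim that the quantity log u = (4/3)ηλ₀³ + cη·log(−(2λ₀²+t)/4) − U satisfies d/dt log u = −ηλ, identifying u with the quantity u of Jimbo–Miwa.) -/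
/-- The quantity `log u = (4/3)ηλ₀³ + cη·log(−(2λ₀²+t)/4) − U` of Jimbo–Miwa
satisfies `d/dt log u = −ηλ`: if `λ₀` is a differentiable branch of the cubic
`2λ₀³ + tλ₀ + c = 0` with `Δ = 6λ₀² + t ≠ 0` and `2λ₀² + t ≠ 0`, `L` is a
differentiable logarithm of `−(2λ₀² + t)/4`, and `W' = η·(λ − λ₀)`, then
`(4/3)·η·λ₀³ + c·η·L − W` has derivative `−η·λ`. -/
theorem log_u_derivative (η c : ℂ) (U : Set ℂ) (hU : IsOpen U)
    (lam lam0 L W : ℂ → ℂ)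
    (hlam0diff : ∀ t ∈ U, DifferentiableAt ℂ lam0 t)
    (hLdiff : ∀ t ∈ U, DifferentiableAt ℂ L t)
    (hcubic : ∀ t ∈ U, 2 * lam0 t ^ 3 + t * lam0 t + c = 0)
    (hΔ : ∀ t ∈ U, 6 * lam0 t ^ 2 + t ≠ 0)
    (hden : ∀ t ∈ U, 2 * lam0 t ^ 2 + t ≠ 0)
    (hexp : ∀ t ∈ U, Complex.exp (L t) = -(2 * lam0 t ^ 2 + t) / 4)
    (hW : ∀ t ∈ U, HasDerivAt W (η * (lam t - lam0 t)) t) :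
    ∀ t ∈ U, HasDerivAt
      (fun u => (4 / 3 : ℂ) * η * lam0 u ^ 3 + c * η * L u - W u)
      (-η * lam t) t := by
  intro t ht
  have hx := (hlam0diff t ht).hasDerivAt
  have hL := (hLdiff t ht).hasDerivAt
  have hrhs : HasDerivAt (fun u => -(2 * lam0 u ^ 2 + u) / 4)
      (-(4 * lam0 t * deriv lam0 t + 1) / 4) t := by
    refine (((hx.fun_pow 2).const_mul 2).fun_add (hasDerivAt_id' t)).fun_neg.div_const 4
      |>.congr_deriv ?_
    push_cast
    ring
  have heq : (fun u => Complex.exp (L u)) =ᶠ[nhds t] fun u => -(2 * lam0 u ^ 2 + u) / 4 :=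
    Filter.eventually_of_mem (hU.mem_nhds ht) hexp
  have hlog : (2 * lam0 t ^ 2 + t) * deriv L t = 4 * lam0 t * deriv lam0 t + 1 := by
    have h := hL.cexp.unique (hrhs.congr_of_eventuallyEq heq)
    rw [hexp t ht] at h
    linear_combination -4 * h
  refine (((hx.fun_pow 3).const_mul (4 / 3 * η)).fun_add (hL.const_mul (c * η))).fun_sub
    (hW t ht) |>.congr_deriv ?_
  push_cast
  linear_combination η * deriv L t * hcubic t ht - η * lam0 t * hlog
end

section
/- Let c ∈ ℂ, R > 0, and let λ : {s ∈ ℂ : |s| > R} → ℂ satisfy 2λ(s)³ + s²·λ(s) + c = 0 for all |s| > R and λ(s)/s → −i/√2 as |s| → ∞. Then there exist R' ≥ R and C > 0 such that for all |s| > R': |λ(s)³ − (i/(2√2))·s³ + (3/4)·c| ≤ C·|s|^{−3}. (Writing t = s², this is λ₀(t,c)³ = (i/(2√2))·t^{3/2} − (3/4)·c + O(t^{−3/2}); in particular λ₀(t,c)³ − λ₀(t,c−η^{−1})³ = −(3/4)·η^{−1} + O(t^{−3/2}), the asymptotic used in deriving the difference equation for the Voros coefficient of (SL_II).) -/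
open Complex Filter

/-- If `α² = -1/2` and `s * (α + e)` solves `2x³ + s²x + c = 0` with `‖e‖ ≤ 1/10`, then
`(s * (α + e))³` agrees with `α³s³ - (3/4)c` up to an error of order `‖s‖⁻³`. -/
theorem norm_cube_sub_le_of_cubic {α s e c : ℂ} (hα : α ^ 2 = -1 / 2) (hs : 0 < ‖s‖)
    (he : ‖e‖ ≤ 1 / 10) (h : 2 * (s * (α + e)) ^ 3 + s ^ 2 * (s * (α + e)) + c = 0) :
    ‖(s * (α + e)) ^ 3 - α ^ 3 * s ^ 3 + (3 / 4 : ℂ) * c‖ ≤ 2 * ‖c‖ ^ 2 / ‖s‖ ^ 3 := by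
  have hα_norm : ‖α‖ ≤ 1 := by
    have h2 : ‖α‖ ^ 2 = 1 / 2 := by rw [← norm_pow, hα]; norm_num
    nlinarith [norm_nonneg α]
  have hc : s ^ 3 * e * (2 - (6 * α * e + 2 * e ^ 2)) = c := by
    linear_combination (-1 : ℂ) * h + s ^ 3 * (2 * α + 6 * e) * hα
  have hE : (s * (α + e)) ^ 3 - α ^ 3 * s ^ 3 + (3 / 4 : ℂ) * c =
      -(s ^ 3 * e ^ 2 * (3 * α + e) / 2) := by
    rw [← hc]
    linear_combination 3 * s ^ 3 * e * hα
  have he0 := norm_nonneg e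
  have hαe : ‖α‖ * ‖e‖ ≤ 1 / 10 := by nlinarith [norm_nonneg α]
  have hsmall : ‖6 * α * e + 2 * e ^ 2‖ ≤ 1 := by
    refine (norm_add_le _ _).trans ?_
    simp only [norm_mul, norm_pow, Complex.norm_ofNat]
    nlinarith
  have hfactor : 1 ≤ ‖2 - (6 * α * e + 2 * e ^ 2)‖ := by
    have := norm_sub_norm_le (2 : ℂ) (6 * α * e + 2 * e ^ 2)
    rw [Complex.norm_ofNat] at this
    linarith
  have hse : ‖s‖ ^ 3 * ‖e‖ ≤ ‖c‖ := by
    rw [← hc, norm_mul, norm_mul, norm_pow]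
    exact le_mul_of_one_le_right (by positivity) hfactor
  have hlin : ‖3 * α + e‖ ≤ 4 := by
    refine (norm_add_le _ _).trans ?_
    rw [norm_mul, Complex.norm_ofNat]
    linarith
  rw [hE, norm_neg, norm_div, norm_mul, norm_mul, norm_pow, norm_pow, Complex.norm_ofNat,
    le_div_iff₀ (by positivity)]
  calc ‖s‖ ^ 3 * ‖e‖ ^ 2 * ‖3 * α + e‖ / 2 * ‖s‖ ^ 3
      = (‖s‖ ^ 3 * ‖e‖) ^ 2 * (‖3 * α + e‖ / 2) := by ring
    _ ≤ ‖c‖ ^ 2 * (4 / 2) := by gcongr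
    _ = 2 * ‖c‖ ^ 2 := by ring

/-- Asymptotics of `λ₀³`: writing `t = s²`, with `λ` the branch of
`2λ³ + tλ + c = 0` with `λ(s)/s → −i/√2`, one has
`λ₀³ = (i/(2√2))·t^{3/2} − (3/4)·c + O(t^{−3/2})`. -/
theorem lambda_zero_cubed_asymptotics (c : ℂ) (R : ℝ) (hR : 0 < R)
    (lam : ℂ → ℂ)
    (hcubic : ∀ s : ℂ, R < ‖s‖ → 2 * lam s ^ 3 + s ^ 2 * lam s + c = 0)
    (hlim : Tendsto (fun s : ℂ => lam s / s)
      (Filter.comap (fun s : ℂ => ‖s‖) Filter.atTop)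
      (nhds (-(Complex.I / (Real.sqrt 2 : ℂ))))) :
    ∃ R' : ℝ, R ≤ R' ∧ ∃ C : ℝ, 0 < C ∧ ∀ s : ℂ, R' < ‖s‖ →
      ‖lam s ^ 3 - (Complex.I / (2 * (Real.sqrt 2 : ℂ))) * s ^ 3 +
        (3 / 4 : ℂ) * c‖ ≤ C / ‖s‖ ^ 3 := by
  set α : ℂ := -(Complex.I / (Real.sqrt 2 : ℂ)) with hα_def
  have hsqrt : ((Real.sqrt 2 : ℝ) : ℂ) ^ 2 = 2 := by
    rw [← Complex.ofReal_pow, Real.sq_sqrt (by norm_num)]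
    norm_num
  have hα : α ^ 2 = -1 / 2 := by
    rw [hα_def, neg_sq, div_pow, Complex.I_sq, hsqrt]
  have hα_cube : Complex.I / (2 * (Real.sqrt 2 : ℂ)) = α ^ 3 := by
    rw [pow_succ, hα, hα_def, mul_comm (2 : ℂ), ← div_div]
    ring
  have hclose := hlim.eventually (Metric.closedBall_mem_nhds α (by norm_num : (0 : ℝ) < 1 / 10))
  obtain ⟨R₁, hR₁⟩ := eventually_atTop.1 (eventually_comap.1 hclose)
  refine ⟨max R R₁, le_max_left _ _, 2 * ‖c‖ ^ 2 + 1, by positivity, fun s hs => ?_⟩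
  have hRs : R < ‖s‖ := (le_max_left _ _).trans_lt hs
  have hs_pos : 0 < ‖s‖ := hR.trans hRs
  have he : ‖lam s / s - α‖ ≤ 1 / 10 :=
    mem_closedBall_iff_norm.1 (hR₁ ‖s‖ ((le_max_right _ _).trans hs.le) s rfl)
  have hlam : s * (α + (lam s / s - α)) = lam s := by
    rw [add_sub_cancel, mul_div_cancel₀ _ (norm_pos_iff.1 hs_pos)]
  have hbound := norm_cube_sub_le_of_cubic (c := c) hα hs_pos he (by
    rw [hlam]
    exact hcubic s hRs)
  rw [hlam] at hbound
  rw [hα_cube]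
  refine hbound.trans ?_
  gcongr
  linarith
end
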